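/- arXiv:1802.01149 — 3 statements merged into one kernel-verified Lean document; each statement's English description precedes it below -/
import Mathlib

section
/- Let V be a real vector space, let Z : V × V → ℝ be a symmetric bilinear form and let F : V × V × V → ℝ be a trilinear map that is symmetric in its last two arguments (i.e. F(X,Y,W) = F(X,W,Y) for all X,Y,W). Suppose there exist linear functionals A, B, D on V such that for all X, Y, W ∈ V, F(X,Y,W) + F(Y,X,W) + F(W,Y,X) = A(X)·Z(Y,W) + B(Y)·Z(X,W) + D(W)·Z(Y,X). Then, setting E = (1/3)(A + B + D), the same identity holds with A, B and D all replaced by E: F(X,Y,W) + F(Y,X,W) + F(W,Y,X) = E(X)·Z(Y,W) + E(Y)·Z(X,W) + E(W)·Z(Y,X) for all X, Y, W ∈ V. -/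
/-- Proposition 2.1 (algebraic form): if the cyclic sum of a trilinear map `F`
(symmetric in its last two arguments) decomposes via a symmetric bilinear form `Z`
with three linear functionals `A`, `B`, `D`, then the same decomposition holds
with all three replaced by `E = (1/3)(A + B + D)`. -/
theorem stmt0 {V : Type*} [AddCommGroup V] [Module ℝ V]
    (Z : V →ₗ[ℝ] V →ₗ[ℝ] ℝ) (hZ : ∀ x y : V, Z x y = Z y x)
    (F : V →ₗ[ℝ] V →ₗ[ℝ] V →ₗ[ℝ] ℝ)
    (hF : ∀ X Y W : V, F X Y W = F X W Y)
    (A B D : V →ₗ[ℝ] ℝ)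
    (h : ∀ X Y W : V, F X Y W + F Y X W + F W Y X =
      A X * Z Y W + B Y * Z X W + D W * Z Y X) :
    ∀ X Y W : V, F X Y W + F Y X W + F W Y X =
      ((1/3 : ℝ) • (A + B + D)) X * Z Y W +
      ((1/3 : ℝ) • (A + B + D)) Y * Z X W +
      ((1/3 : ℝ) • (A + B + D)) W * Z Y X := by
  intro X Y W
  have h₁ := h X Y W
  have h₂ := h Y W X
  have h₃ := h W X Y
  rw [hF Y W X, hF X W Y, hZ W X, hZ W Y] at h₂
  rw [hF W X Y, hF X W Y, hZ X Y, hZ W Y] at h₃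
  simp only [LinearMap.smul_apply, LinearMap.add_apply, smul_eq_mul]
  linarith
end

section
/- Let V be a real vector space, let Z : V × V → ℝ be a symmetric bilinear form and let C : V × V × V → ℝ be a fully symmetric trilinear map. Then the following are equivalent: (i) there exist linear functionals A, B, D on V with C(X,Y,W) = A(X)·Z(Y,W) + B(Y)·Z(X,W) + D(W)·Z(Y,X) for all X, Y, W; (ii) there exists a single linear functional E on V with C(X,Y,W) = E(X)·Z(Y,W) + E(Y)·Z(X,W) + E(W)·Z(Y,X) for all X, Y, W. Moreover, in the forward direction one may take E = (1/3)(A + B + D). -/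
/-- Equivalence form of Proposition 2.1: a fully symmetric trilinear map `C`
decomposes via a symmetric bilinear form `Z` with three linear functionals
iff it decomposes with a single linear functional; in the forward direction
one may take `E = (1/3)(A + B + D)`. -/
theorem stmt3 {V : Type*} [AddCommGroup V] [Module ℝ V]
    (Z : V →ₗ[ℝ] V →ₗ[ℝ] ℝ) (hZ : ∀ x y : V, Z x y = Z y x)
    (C : V →ₗ[ℝ] V →ₗ[ℝ] V →ₗ[ℝ] ℝ)
    (hC : ∀ (σ : Equiv.Perm (Fin 3)) (v : Fin 3 → V),
      C (v (σ 0)) (v (σ 1)) (v (σ 2)) = C (v 0) (v 1) (v 2)) :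
    ((∃ A B D : V →ₗ[ℝ] ℝ, ∀ X Y W : V,
        C X Y W = A X * Z Y W + B Y * Z X W + D W * Z Y X) ↔
      (∃ E : V →ₗ[ℝ] ℝ, ∀ X Y W : V,
        C X Y W = E X * Z Y W + E Y * Z X W + E W * Z Y X)) ∧
    (∀ A B D : V →ₗ[ℝ] ℝ,
      (∀ X Y W : V, C X Y W = A X * Z Y W + B Y * Z X W + D W * Z Y X) →
      (∀ X Y W : V, C X Y W =
        ((1/3 : ℝ) • (A + B + D)) X * Z Y W +
        ((1/3 : ℝ) • (A + B + D)) Y * Z X W +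
        ((1/3 : ℝ) • (A + B + D)) W * Z Y X)) := by
  have cyclic (X Y W : V) : C Y W X = C X Y W := by
    simpa using hC (finRotate 3) ![X, Y, W]
  have average (A B D : V →ₗ[ℝ] ℝ)
      (h : ∀ X Y W : V, C X Y W = A X * Z Y W + B Y * Z X W + D W * Z Y X) (X Y W : V) :
      C X Y W =
        ((1/3 : ℝ) • (A + B + D)) X * Z Y W +
        ((1/3 : ℝ) • (A + B + D)) Y * Z X W +
        ((1/3 : ℝ) • (A + B + D)) W * Z Y X := by
    have h₁ := h X Y W
    have h₂ := h Y W X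
    have h₃ := h W X Y
    rw [cyclic X Y W, hZ W X, hZ W Y] at h₂
    rw [← cyclic W X Y, hZ X Y, hZ W Y] at h₃
    simp only [LinearMap.smul_apply, LinearMap.add_apply, smul_eq_mul]
    linarith
  exact ⟨⟨fun ⟨A, B, D, h⟩ => ⟨_, average A B D h⟩, fun ⟨E, h⟩ => ⟨E, E, E, h⟩⟩, average⟩
end

section
/- Let V be a real vector space, let k ≥ 2, let T : V^k → ℝ be a multilinear map, and let i ≠ j be indices in {1,…,k} such that T is symmetric under transposing its i-th and j-th arguments. Let U : V × V^k → ℝ be multilinear in all k+1 arguments and suppose that for each fixed first argument X, the map (X₁,…,X_k) ↦ U(X; X₁,…,X_k) is also symmetric under transposing the i-th and j-th of the arguments X₁,…,X_k. Suppose there exist linear functionals π, π₁, …, π_k on V such that U(X; X₁,…,X_k) = π(X)·T(X₁,…,X_k) + Σ_{m=1}^{k} π_m(X_m)·T(X₁,…,X_{m-1}, X, X_{m+1},…,X_k) for all X, X₁,…,X_k ∈ V. Then the same identity holds with π_i and π_j both replaced by their average σ = (1/2)(π_i + π_j), all other 1-forms unchanged. -/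
/-- Theorem A (for one symmetric pair of indices): if a k-linear map `T` is
symmetric under the transposition of its `i`-th and `j`-th arguments, `U` is
(k+1)-linear with the same pair-symmetry in its last `k` arguments, and `U`
decomposes as `π(X)·T(X₁,…,X_k) + Σ_m π_m(X_m)·T(…,X,…)`, then the same identity
holds with `π_i` and `π_j` both replaced by their average `(1/2)(π_i + π_j)`. -/
theorem stmt4 {V : Type*} [AddCommGroup V] [Module ℝ V]
    (k : ℕ) (hk : 2 ≤ k)
    (T : MultilinearMap ℝ (fun _ : Fin k => V) ℝ)
    (i j : Fin k) (hij : i ≠ j)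
    (hT : ∀ v : Fin k → V, T (v ∘ Equiv.swap i j) = T v)
    (U : V →ₗ[ℝ] MultilinearMap ℝ (fun _ : Fin k => V) ℝ)
    (hU : ∀ (X : V) (v : Fin k → V), U X (v ∘ Equiv.swap i j) = U X v)
    (π : V →ₗ[ℝ] ℝ) (p : Fin k → (V →ₗ[ℝ] ℝ))
    (h : ∀ (X : V) (v : Fin k → V),
      U X v = π X * T v + ∑ m : Fin k, p m (v m) * T (Function.update v m X)) :
    ∀ (X : V) (v : Fin k → V),
      U X v = π X * T v +
        ∑ m : Fin k,
          (if m = i ∨ m = j then (1/2 : ℝ) • (p i + p j) else p m) (v m) *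
            T (Function.update v m X) := by
  intro X v
  have hswap : U X v = π X * T v +
      ∑ m : Fin k, p (Equiv.swap i j m) (v m) * T (Function.update v m X) := by
    rw [← hU X v, h X (v ∘ Equiv.swap i j), hT v]
    congr 1
    refine Fintype.sum_equiv (Equiv.swap i j) _ _ fun m => ?_
    rw [← hT (Function.update v (Equiv.swap i j m) X), Function.update_comp_equiv]
    simp
  have hsum : ∑ m : Fin k,
      (if m = i ∨ m = j then (1/2 : ℝ) • (p i + p j) else p m) (v m) *
        T (Function.update v m X) =
      (1/2 : ℝ) * (∑ m : Fin k, p m (v m) * T (Function.update v m X) +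
        ∑ m : Fin k, p (Equiv.swap i j m) (v m) * T (Function.update v m X)) := by
    rw [← Finset.sum_add_distrib, Finset.mul_sum]
    refine Finset.sum_congr rfl fun m _ => ?_
    by_cases hi : m = i
    · subst hi
      simp
      ring
    · by_cases hj : m = j
      · subst hj
        simp
        ring
      · rw [if_neg (by tauto), Equiv.swap_apply_of_ne_of_ne hi hj]
        ring
  linarith [h X v]
end
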